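/- arXiv:1811.01130 — 2 statements merged into one kernel-verified Lean document; each statement's English description precedes it below -/
import Mathlib

section
/- For each k ∈ ℤ_{≥0} there is a constant C_k such that for all real u and all real τ with 0 < τ ≤ 1, one has τ^{k/2}·|Υ^{(k)}(u; τ)| ≤ C_k·τ^{−1/2}·(1 + |u|)·(1 + (1 + |u|^k)/τ^{k/2}), where Υ^{(k)}(u;τ) denotes the k-th derivative of the entire function u ↦ Υ(u;τ) evaluated at u. -/
open Complex Real MeasureTheory

noncomputable section

def chi (s : ℂ) : ℂ := (π : ℂ) ^ (s - 1/2) * Complex.Gamma ((1 - s)/2) / Complex.Gamma (s/2)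

def RSOmega : Set ℂ := {s : ℂ | s.im ≠ 0 ∨ (0 < s.re ∧ s.re < 1)}

def IsRSTheta (ϑ : ℂ → ℂ) : Prop :=
  DifferentiableOn ℂ ϑ RSOmega ∧ (∀ s ∈ RSOmega, Complex.exp (-2 * I * ϑ s) = chi s) ∧
    ϑ (1/2) = 0

def zetaSum (x : ℝ) (s : ℂ) : ℂ := ∑ n ∈ Finset.Icc 1 ⌊x⌋₊, (n : ℂ) ^ (-s)

def Upsilon (u τ : ℂ) : ℂ :=
  ∫ v : ℝ, Complex.exp (3 * (π:ℂ) * I / 4) *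
    (Complex.exp (-(π:ℂ) * I * τ * (1/2 + Complex.exp (3 * (π:ℂ) * I / 4) * v) ^ 2
        + 2 * (π:ℂ) * I * u * (1/2 + Complex.exp (3 * (π:ℂ) * I / 4) * v)) /
      (Complex.exp (2 * (π:ℂ) * I * (1/2 + Complex.exp (3 * (π:ℂ) * I / 4) * v)) - 1))

def G (u τ : ℂ) : ℂ :=
  τ ^ ((1:ℂ)/4) * Complex.exp (-(π:ℂ) * I * u ^ 2 / 2 + (π:ℂ) * I / 8) *
    Upsilon (τ ^ ((1:ℂ)/2) * u) τ

def Gderiv (k : ℕ) (u τ : ℂ) : ℂ := iteratedDeriv k (fun w => G w τ) u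

def hermiteH (n : ℕ) (x : ℂ) : ℂ :=
  (Nat.factorial n : ℂ) * ∑ j ∈ Finset.range (n / 2 + 1),
    (-1:ℂ) ^ j / ((Nat.factorial j : ℂ) * (Nat.factorial (n - 2*j) : ℂ)) * (2 * x) ^ (n - 2*j)

def obell (p : ℕ → ℂ) (i j : ℕ) : ℂ :=
  ∑ f ∈ (Finset.Nat.antidiagonalTuple j i).filter (fun f => ∀ l, 1 ≤ f l), ∏ l, p (f l)

def bernoulliPoly (n : ℕ) (x : ℂ) : ℂ := Polynomial.aeval x (Polynomial.bernoulli n)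

def fseq (σ : ℝ) (n : ℕ) : ℂ :=
  (bernoulliPoly (n+1) ((σ:ℂ)/2) + (-1:ℂ)^(n+1) * bernoulliPoly (n+1) ((1-(σ:ℂ))/2)) /
    (2*(n:ℂ)*((n:ℂ)+1))

def um (m : ℕ) (σ : ℝ) : ℂ :=
  (-2:ℂ)^m * ∑ k ∈ Finset.range (m+1), obell (fseq σ) m k / (Nat.factorial k : ℂ)

def seqA (j : ℕ) : ℂ := (-1:ℂ)^(j+1) / ((j:ℂ) + 2)

def seqB (j : ℕ) : ℂ := (-1:ℂ)^(j+1) / (j:ℂ)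

def dd (m r : ℕ) (σ : ℝ) : ℂ :=
  ∑ n ∈ Finset.Icc r m, (obell seqA n r / (Nat.factorial r : ℂ)) *
    ∑ k ∈ Finset.range (m - n + 1),
      (obell seqB (m - n) k / (Nat.factorial k : ℂ)) * ((σ:ℂ) - 1)^k

def qq (n ℓ : ℕ) (σ : ℝ) : ℂ :=
  ∑ m ∈ Finset.Icc (ℓ - n) (ℓ / 3), um m σ * dd (n - 2*m) (n + m - ℓ) σ

def PP (n k : ℕ) (x : ℂ) (σ : ℝ) : ℂ :=
  Complex.exp (3 * (π:ℂ) * I * (k:ℂ) / 4) * ∑ ℓ ∈ Finset.range (k/2 + 1),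
    (Nat.choose (3*n - 2*ℓ) (3*n - k) : ℂ) * (-1:ℂ)^(n + ℓ) * 2^(2*ℓ) / 2^k *
      qq n ℓ σ * hermiteH (k - 2*ℓ) (Complex.exp (-(π:ℂ) * I / 4) * x)

def IsAk (s : ℂ) (a : ℕ → ℂ) : Prop :=
  a 0 = 1 ∧ ∀ k : ℕ, ((k:ℂ) + 1) * (Real.sqrt s.im : ℂ) * a (k+1) =
    -((k:ℂ) + 1 - (s.re:ℂ)) * a k + I * (if 2 ≤ k then a (k-2) else 0)

def IsPsi (Ψ : ℂ → ℂ) : Prop :=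
  Differentiable ℂ Ψ ∧ ∀ u : ℂ, Complex.cos ((π:ℂ)*u) ≠ 0 →
    Ψ u = Complex.cos ((π:ℂ)*(u^2/2 - u - 1/8)) / Complex.cos ((π:ℂ)*u)

def wfun (s z : ℂ) : ℂ :=
  Complex.exp ((s - 1) * Complex.log (1 + z / (Real.sqrt s.im : ℂ))
    - I * (Real.sqrt s.im : ℂ) * z + I * z^2 / 2)

def rn (n : ℕ) (s z : ℂ) : ℂ :=
  wfun s z - ∑ k ∈ Finset.range n, (iteratedDeriv k (wfun s) 0 / (Nat.factorial k : ℂ)) * z^k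

def GammaOmega : Set ℂ := {s : ℂ | s.im ≠ 0 ∨ 0 < s.re}

def IsLogGamma (L : ℂ → ℂ) : Prop :=
  DifferentiableOn ℂ L GammaOmega ∧ (∀ s ∈ GammaOmega, Complex.exp (L s) = Complex.Gamma s) ∧
    L 1 = 0

def gseq (σ : ℝ) (n : ℕ) : ℂ := -(bernoulliPoly (n+1) (σ:ℂ)) / ((n:ℂ)*((n:ℂ)+1))

def gammam (m : ℕ) (σ : ℝ) : ℂ :=
  I^m * ∑ k ∈ Finset.range (m+1), obell (gseq σ) m k / (Nat.factorial k : ℂ)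

def omg : ℂ := Complex.exp (3 * (π:ℂ) * I / 4)

lemma omg_eq : omg = ((-(√2/2) : ℝ) : ℂ) + ((√2/2 : ℝ) : ℂ) * I := by
  unfold omg
  have h : (3 * (π:ℂ) * I / 4) = ((π - π/4 : ℝ) : ℂ) * I := by push_cast; ring
  rw [h, Complex.exp_mul_I, ← Complex.ofReal_cos, ← Complex.ofReal_sin, Real.cos_pi_sub,
    Real.sin_pi_sub, Real.cos_pi_div_four, Real.sin_pi_div_four]

lemma s_sq : (√2/2 : ℝ)^2 = 1/2 := by
  rw [div_pow, Real.sq_sqrt (by norm_num)]; norm_num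

lemma s_pos : 0 < (√2/2 : ℝ) := by positivity

lemma s_le : (√2/2 : ℝ) ≤ 1 := by nlinarith [s_sq, s_pos]

lemma omg_sq : omg ^ 2 = -I := by
  have h : ((√2/2 : ℝ) : ℂ)^2 = 1/2 := by
    rw [← Complex.ofReal_pow, s_sq]; norm_num
  rw [omg_eq, Complex.ofReal_neg]
  linear_combination (1 + I^2 - 2*I) * h + (1/2) * I_sq

lemma omg_norm : ‖omg‖ = 1 := by
  have h : (3 * (π:ℂ) * I / 4) = ((3 * π/4 : ℝ) : ℂ) * I := by push_cast; ring
  unfold omg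
  rw [h, Complex.norm_exp_ofReal_mul_I]

/-- the denominator -/
def den (v : ℝ) : ℂ := Complex.exp (2 * (π:ℂ) * I * (1/2 + omg * v)) - 1

lemma exp_aux (t : ℝ) (ht : 0 ≤ t) (ε : ℝ) (hε : ε = t ∨ ε = -t) :
    1/2 ≤ ‖1 + Complex.exp (((-t : ℝ) : ℂ) + ((ε:ℝ):ℂ) * I)‖ := by
  by_cases h : t ≤ π/2
  · have hre : (1 + Complex.exp (((-t : ℝ) : ℂ) + ((ε:ℝ):ℂ) * I)).re
        = 1 + Real.exp (-t) * Real.cos ε := by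
      simp [Complex.exp_re]
    have hc : 0 ≤ Real.cos ε := by
      apply Real.cos_nonneg_of_mem_Icc
      constructor <;> rcases hε with h1 | h1 <;> linarith
    have := Complex.re_le_norm (1 + Complex.exp (((-t : ℝ) : ℂ) + ((ε:ℝ):ℂ) * I))
    rw [hre] at this
    nlinarith [Real.exp_pos (-t), mul_nonneg (Real.exp_pos (-t)).le hc]
  · push Not at h
    have h2 : ‖Complex.exp (((-t : ℝ) : ℂ) + ((ε:ℝ):ℂ) * I)‖ = Real.exp (-t) := by
      simp [Complex.norm_exp]
    have h3 : Real.exp (-t) ≤ 1/2 := by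
      rw [Real.exp_neg, one_div]
      apply inv_anti₀ (by norm_num)
      have := Real.add_one_le_exp t
      have := Real.pi_gt_three
      linarith
    have h4 := norm_sub_norm_le (1:ℂ) (-Complex.exp (((-t : ℝ) : ℂ) + ((ε:ℝ):ℂ) * I))
    rw [sub_neg_eq_add, norm_neg, h2, norm_one] at h4
    linarith

lemma den_eq (v : ℝ) : den v = -(1 + Complex.exp (((-(2*π*(√2/2)*v) : ℝ) : ℂ) +
    ((-(2*π*(√2/2)*v) : ℝ):ℂ) * I)) := by
  unfold den
  have : (2 * (π:ℂ) * I * (1/2 + omg * v)) = π * I + (((-(2*π*(√2/2)*v) : ℝ) : ℂ) +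
    ((-(2*π*(√2/2)*v) : ℝ):ℂ) * I) := by
    rw [omg_eq]; push_cast
    linear_combination (2 * (π:ℂ) * (√2/2) * v) * I_sq
  rw [this, Complex.exp_add, Complex.exp_pi_mul_I]; ring

lemma den_lower_pos (v : ℝ) (hv : 0 ≤ v) : 1/2 ≤ ‖den v‖ := by
  rw [den_eq, norm_neg]
  apply exp_aux _ (by positivity) _ (Or.inr rfl)

lemma den_lower_neg (v : ℝ) (hv : v ≤ 0) : Real.exp (-(2*π*(√2/2)*v)) / 2 ≤ ‖den v‖ := by
  rw [den_eq, norm_neg]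
  set t := 2*π*(√2/2)*v with ht
  have ht0 : t ≤ 0 := mul_nonpos_of_nonneg_of_nonpos (by positivity) hv
  have h1 : 1 + Complex.exp (((-t : ℝ) : ℂ) + ((-t : ℝ):ℂ) * I) =
      Complex.exp (((-t : ℝ) : ℂ) + ((-t : ℝ):ℂ) * I) *
       (1 + Complex.exp (((-(-t) : ℝ) : ℂ) + ((t : ℝ):ℂ) * I)) := by
    rw [mul_add, ← Complex.exp_add, mul_one, add_comm]
    congr 1
    rw [eq_comm, Complex.exp_eq_one_iff]
    use 0; push_cast; ring
  rw [h1, norm_mul]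
  have h2 : ‖Complex.exp (((-t : ℝ) : ℂ) + ((-t:ℝ):ℂ) * I)‖ = Real.exp (-t) := by
      simp [Complex.norm_exp]
  rw [h2]
  have := exp_aux (-t) (by linarith) t (Or.inr (by ring))
  nlinarith [Real.exp_pos (-t)]

lemma den_lower (v : ℝ) : 1/2 ≤ ‖den v‖ := by
  rcases le_total 0 v with h | h
  · exact den_lower_pos v h
  · have := den_lower_neg v h
    have h2 : 1 ≤ Real.exp (-(2*π*(√2/2)*v)) := by
      apply Real.one_le_exp
      have : 2*π*(√2/2)*v ≤ 0 := mul_nonpos_of_nonneg_of_nonpos (by positivity) h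
      linarith
    linarith

lemma den_ne (v : ℝ) : den v ≠ 0 := by
  have := den_lower v
  intro h; rw [h, norm_zero] at this; linarith

/-- the numerator -/
def num (τ : ℝ) (w : ℂ) (v : ℝ) : ℂ := Complex.exp (-(π:ℂ) * I * τ * (1/2 + omg * v) ^ 2
        + 2 * (π:ℂ) * I * w * (1/2 + omg * v))

lemma Ups_eq (τ : ℝ) (w : ℂ) : Upsilon w τ = ∫ v : ℝ, omg * (num τ w v / den v) := rfl

lemma num_norm (τ : ℝ) (w : ℂ) (v : ℝ) : ‖num τ w v‖ = Real.exp (-π*τ*v^2 + π*τ*(√2/2)*v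
    - 2*π*(w.re*(√2/2)*v + w.im*(1/2 - (√2/2)*v))) := by
  unfold num
  rw [Complex.norm_exp]
  congr 1
  have : (-(π:ℂ) * I * τ * (1/2 + omg * v) ^ 2 + 2 * (π:ℂ) * I * w * (1/2 + omg * v))
   = ((-π*τ*v^2:ℝ):ℂ) + I * ((-π*τ/4 : ℝ):ℂ) - I * ((π*τ*v:ℝ):ℂ) * omg +
      ((2*π:ℝ):ℂ) * I * w * (1/2 + omg * v) := by
    push_cast
    linear_combination (-(π:ℂ) * I * τ * v^2) * omg_sq + (π:ℂ) * τ * v^2 * I_sq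
  rw [this, omg_eq]
  simp [← Complex.ofReal_pow]
  ring

lemma num_cont (τ : ℝ) (w : ℂ) : Continuous (num τ w) := by
  unfold num; fun_prop

lemma den_cont : Continuous den := by
  unfold den; fun_prop

lemma F_cont (τ : ℝ) (w : ℂ) : Continuous (fun v => omg * (num τ w v / den v)) :=
  continuous_const.mul ((num_cont τ w).div den_cont den_ne)

lemma F_norm (τ : ℝ) (w : ℂ) (v : ℝ) : ‖omg * (num τ w v / den v)‖ ≤ 2 * ‖num τ w v‖ := by
  rw [norm_mul, omg_norm, one_mul, norm_div]
  rw [div_le_iff₀ (by linarith [den_lower v])]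
  nlinarith [den_lower v, norm_nonneg (num τ w v)]

lemma num_bound (τ : ℝ) (hτ : 0 < τ) (hτ1 : τ ≤ 1) (R : ℝ) (w : ℂ) (hw : ‖w‖ ≤ R) (v : ℝ) :
    ‖num τ w v‖ ≤ Real.exp (-(π*τ)*v^2 + π*(1+4*R)*|v| + π*R) := by
  rw [num_norm]
  apply Real.exp_le_exp.mpr
  have h1 : |w.re| ≤ R := (Complex.abs_re_le_norm w).trans hw
  have h2 : |w.im| ≤ R := (Complex.abs_im_le_norm w).trans hw
  have hR : 0 ≤ R := (abs_nonneg _).trans h1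
  set s := √2/2
  have hs : 0 < s := s_pos
  have hs1 : s ≤ 1 := s_le
  have hsv : |s*v| ≤ |v| := by
    rw [abs_mul, abs_of_pos hs]; nlinarith [abs_nonneg v]
  have e1 : τ*(s*v) ≤ |v| := by
    have := le_abs_self (s*v)
    nlinarith [abs_nonneg v, abs_nonneg (s*v)]
  have e2 : -(w.re*(s*v)) ≤ R*|v| := by
    rw [← neg_mul]
    refine (le_abs_self _).trans ?_
    rw [abs_mul, abs_neg]; gcongr
  have e3 : (w.im*(s*v)) ≤ R*|v| := by
    refine (le_abs_self _).trans ?_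
    rw [abs_mul]; gcongr
  have e4 : -w.im ≤ R := (neg_le_abs _).trans h2
  have : -π*τ*v^2 + π*τ*s*v - 2*π*(w.re*s*v + w.im*(1/2 - s*v)) =
    -(π*τ)*v^2 + π*(τ*(s*v) + 2*(-(w.re*(s*v))) + -w.im + 2*(w.im*(s*v))) := by ring
  rw [this]
  have : -(π*τ)*v^2 + π*(1+4*R)*|v| + π*R = -(π*τ)*v^2 + π*(|v| + 2*(R*|v|) + R + 2*(R*|v|)) := by ring
  rw [this]
  gcongr

lemma gauss_dom (a c d v : ℝ) (ha : 0 < a) :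
    Real.exp (-a*v^2 + c*|v| + d) ≤ Real.exp (c^2/(2*a) + d) * Real.exp (-(a/2)*v^2) := by
  rw [← Real.exp_add]
  apply Real.exp_le_exp.mpr
  have : c^2/(2*a) + d + -(a/2)*v^2 - (-a*v^2 + c*|v| + d) = (c - a*|v|)^2/(2*a) := by
    rw [← sq_abs v]; field_simp; ring
  have : 0 ≤ (c - a*|v|)^2/(2*a) := by positivity
  linarith

lemma F_int (τ : ℝ) (hτ : 0 < τ) (hτ1 : τ ≤ 1) (w : ℂ) :
    Integrable (fun v => omg * (num τ w v / den v)) := by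
  have hi := ((integrable_exp_neg_mul_sq (show 0 < π*τ/2 by positivity)).const_mul
    (2 * Real.exp ((π*(1+4*‖w‖))^2/(2*(π*τ)) + π*‖w‖)))
  refine hi.mono' (F_cont τ w).aestronglyMeasurable (Filter.Eventually.of_forall fun v => ?_)
  refine (F_norm τ w v).trans ?_
  rw [mul_assoc]
  gcongr
  exact (num_bound τ hτ hτ1 _ w le_rfl v).trans (gauss_dom _ _ _ _ (by positivity))

lemma Ups_diff (τ : ℝ) (hτ : 0 < τ) (hτ1 : τ ≤ 1) : Differentiable ℂ (fun w => Upsilon w τ) := by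
  intro w₀
  simp only [Ups_eq]
  set R := ‖w₀‖ + 1 with hR
  have hR0 : 0 ≤ R := by positivity
  have hi := ((integrable_exp_neg_mul_sq (show 0 < π*τ/2 by positivity)).const_mul
    ((2 * π * 2) * Real.exp ((π*(1+4*R) + 1)^2/(2*(π*τ)) + π*R)))
  refine (hasDerivAt_integral_of_dominated_loc_of_deriv_le (𝕜 := ℂ) (x₀ := w₀)
    (F' := fun w v => (2 * (π:ℂ) * I * (1/2 + omg * v)) * (omg * (num τ w v / den v)))
    (Metric.ball_mem_nhds w₀ one_pos)
    (Filter.Eventually.of_forall fun w => (F_cont τ w).aestronglyMeasurable)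
    (F_int τ hτ hτ1 w₀) ?_ (Filter.Eventually.of_forall fun v w hw => ?_) hi
    (Filter.Eventually.of_forall fun v w hw => ?_)).2.differentiableAt
  · apply Continuous.aestronglyMeasurable
    exact Continuous.mul (by fun_prop) (F_cont τ w₀)
  · have hwR : ‖w‖ ≤ R := by
      rw [mem_ball_iff_norm] at hw
      have := norm_sub_norm_le w w₀
      linarith
    have h1 : ‖2 * (π:ℂ) * I * (1/2 + omg * v)‖ ≤ 2 * π * Real.exp |v| := by
      rw [norm_mul]
      have : ‖2 * (π:ℂ) * I‖ = 2 * π := by simp [abs_of_pos Real.pi_pos]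
      rw [this]
      gcongr
      refine (norm_add_le _ _).trans ?_
      rw [norm_mul, omg_norm, Complex.norm_real]
      have := Real.add_one_le_exp |v|
      norm_num
      linarith
    rw [norm_mul]
    refine (mul_le_mul h1 ((F_norm τ w v).trans (mul_le_mul_of_nonneg_left
      (num_bound τ hτ hτ1 R w hwR v) (by norm_num))) (norm_nonneg _) (by positivity)).trans ?_
    have := gauss_dom (π*τ) (π*(1+4*R) + 1) (π*R) v (by positivity)
    have e : Real.exp (-(π*τ)*v^2 + (π*(1+4*R)+1)*|v| + π*R) = Real.exp |v| *
       Real.exp (-(π*τ)*v^2 + π*(1+4*R)*|v| + π*R) := by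
      rw [← Real.exp_add]; ring_nf
    rw [e] at this
    calc _ = (2*π*2) * (Real.exp |v| * Real.exp (-(π*τ)*v^2 + π*(1+4*R)*|v| + π*R)) := by ring
      _ ≤ (2*π*2) * _ := mul_le_mul_of_nonneg_left this (by positivity)
      _ = _ := by ring
  · have h0 : HasDerivAt (fun w : ℂ => -(π:ℂ) * I * τ * (1/2 + omg * v) ^ 2
        + 2 * (π:ℂ) * I * w * (1/2 + omg * v)) (2 * (π:ℂ) * I * (1/2 + omg * v)) w := by
      have := (((hasDerivAt_id w).const_mul (2 * (π:ℂ) * I)).mul_const (1/2 + omg * v)).const_add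
        (-(π:ℂ) * I * τ * (1/2 + omg * v) ^ 2)
      simpa using this
    have h1 := ((h0.cexp).div_const (den v)).const_mul omg
    refine h1.congr_deriv ?_
    unfold num; ring

lemma Ups_rec (τ : ℝ) (hτ : 0 < τ) (hτ1 : τ ≤ 1) (w : ℂ) :
    ‖Upsilon (w+1) τ - Upsilon w τ‖ = τ ^ (-(1:ℝ)/2) * Real.exp (-(2*π*w.re*w.im/τ)) := by
  have hτc : (τ:ℂ) ≠ 0 := by exact_mod_cast hτ.ne'
  have hπc : (π:ℂ) ≠ 0 := by exact_mod_cast Real.pi_ne_zero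
  rw [Ups_eq, Ups_eq, ← integral_sub (F_int τ hτ hτ1 _) (F_int τ hτ hτ1 _)]
  have h : ∀ v : ℝ, omg * (num τ (w+1) v / den v) - omg * (num τ w v / den v) =
      omg * Complex.exp ((-(π:ℂ)*τ) * (v:ℂ)^2 + ((π:ℂ) * I * omg * (2*w - τ)) * v +
        (-(π:ℂ)*I*τ/4 + π * I * w)) := by
    intro v
    have e1 : num τ (w+1) v = num τ w v * (den v + 1) := by
      unfold num den
      rw [sub_add_cancel, ← Complex.exp_add]
      congr 1; ring
    have e2 : num τ w v = Complex.exp ((-(π:ℂ)*τ) * (v:ℂ)^2 + ((π:ℂ) * I * omg * (2*w - τ)) * v +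
        (-(π:ℂ)*I*τ/4 + π * I * w)) := by
      unfold num
      congr 1
      linear_combination (-(π:ℂ) * I * τ * v^2) * omg_sq + (π:ℂ) * τ * v^2 * I_sq
    rw [e1, ← e2]
    have := den_ne v
    field_simp
    ring
  simp_rw [h]
  rw [integral_const_mul, integral_cexp_quadratic (by simp; positivity), norm_mul, omg_norm,
    one_mul, norm_mul]
  congr 1
  · have : (π:ℂ) / -(-(π:ℂ)*τ) = ((τ⁻¹ : ℝ):ℂ) := by push_cast; field_simp
    rw [this, Complex.norm_cpow_eq_rpow_re_of_pos (by positivity), Real.inv_rpow hτ.le,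
      ← Real.rpow_neg hτ.le]
    norm_num
  · have : (-(π:ℂ)*I*τ/4 + π * I * w) - ((π:ℂ) * I * omg * (2*w - τ))^2 / (4 * (-(π:ℂ)*τ)) =
       ((π/τ : ℝ):ℂ) * (I * w^2) := by
      have : ((π:ℂ) * I * omg * (2*w - τ))^2 = I * (π:ℂ)^2 * (2*w-τ)^2 := by
        linear_combination ((π:ℂ)^2 * I^2 * (2*w-τ)^2) * omg_sq - I * (π:ℂ)^2 * (2*w-τ)^2 * I_sq
      rw [this]; push_cast; field_simp; ring
    rw [this, Complex.norm_exp, Complex.re_ofReal_mul]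
    congr 1
    simp [pow_two]; field_simp; ring

lemma Ups_base : ∃ C : ℝ, 0 ≤ C ∧ ∀ τ : ℝ, 0 < τ → τ ≤ 1 → ∀ w : ℂ, 0 ≤ w.re → w.re ≤ 1 →
    |w.im| ≤ 3 * τ → ‖Upsilon w τ‖ ≤ C * τ ^ (-(1:ℝ)/2) := by
  refine ⟨2 * Real.exp ((7*π)^2/(2*π) + 3 * π) * √2, by positivity, fun τ hτ hτ1 w h0 h1 hb => ?_⟩
  rw [Ups_eq]
  have hi := ((integrable_exp_neg_mul_sq (show 0 < π*τ/2 by positivity)).const_mul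
    (2 * Real.exp ((7*π)^2/(2*π) + 3 * π)))
  refine (norm_integral_le_of_norm_le hi (Filter.Eventually.of_forall fun v => ?_)).trans ?_
  · have hs : 0 < √2/2 := s_pos
    have hs1 : √2/2 ≤ 1 := s_le
    have e1 : ‖omg * (num τ w v / den v)‖ ≤ 2 * Real.exp (-(π*τ)*v^2 + (7*π*τ)*|v| + 3*π*τ) := by
      rw [norm_mul, omg_norm, one_mul, norm_div, num_norm]
      have hd : 0 < ‖den v‖ := by linarith [den_lower v]
      rw [div_le_iff₀ hd]
      set s := √2/2
      have hsv : |s*v| ≤ |v| := by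
        rw [abs_mul, abs_of_pos hs]; nlinarith [abs_nonneg v]
      have a1 : τ*(s*v) ≤ τ*|v| := by
        gcongr; exact (le_abs_self _).trans hsv
      have a3 : (w.im*(s*v)) ≤ 3*τ*|v| := by
        refine (le_abs_self _).trans ?_
        rw [abs_mul]; gcongr
      have a4 : -w.im ≤ 3*τ := (neg_le_abs _).trans hb
      have key : Real.exp (-(2*π*s*v*w.re)) ≤ 2 * ‖den v‖ := by
        rcases le_total 0 v with hv | hv
        · have : Real.exp (-(2*π*s*v*w.re)) ≤ 1 := by
            apply Real.exp_le_one_iff.mpr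
            have : 0 ≤ 2*π*s*v*w.re := by positivity
            linarith
          linarith [den_lower_pos v hv]
        · have h3 := den_lower_neg v hv
          have : Real.exp (-(2*π*s*v*w.re)) ≤ Real.exp (-(2*π*s*v)) := by
            apply Real.exp_le_exp.mpr
            have : 2*π*s*v ≤ 0 := mul_nonpos_of_nonneg_of_nonpos (by positivity) hv
            nlinarith
          linarith
      have e : -π*τ*v^2 + π*τ*s*v - 2*π*(w.re*s*v + w.im*(1/2 - s*v)) =
        -(2*π*s*v*w.re) + (-(π*τ)*v^2 + π*(τ*(s*v) + -w.im + 2*(w.im*(s*v)))) := by ring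
      rw [e, Real.exp_add]
      have e2 : Real.exp (-(π*τ)*v^2 + π*(τ*(s*v) + -w.im + 2*(w.im*(s*v)))) ≤
          Real.exp (-(π*τ)*v^2 + (7*π*τ)*|v| + 3*π*τ) := by
        apply Real.exp_le_exp.mpr
        have : -(π*τ)*v^2 + (7*π*τ)*|v| + 3*π*τ = -(π*τ)*v^2 + π*(τ*|v| + 3*τ + 2*(3*τ*|v|)) := by ring
        rw [this]; gcongr
      calc _ ≤ (2 * ‖den v‖) * Real.exp (-(π*τ)*v^2 + (7*π*τ)*|v| + 3*π*τ) := by gcongr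
        _ = _ := by ring
    refine e1.trans ?_
    rw [mul_assoc 2 (Real.exp _)]
    refine mul_le_mul_of_nonneg_left ?_ (by norm_num)
    refine (gauss_dom _ _ _ _ (by positivity)).trans ?_
    refine mul_le_mul_of_nonneg_right (Real.exp_le_exp.mpr (add_le_add ?_ ?_)) (Real.exp_pos _).le
    · have : (7*π*τ)^2/(2*(π*τ)) = (7*π)^2/(2*π) * τ := by field_simp
      rw [this]
      exact mul_le_of_le_one_right (by positivity) hτ1
    · exact mul_le_of_le_one_right (by positivity) hτ1
  · rw [integral_const_mul, integral_gaussian]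
    have : √(π/(π*τ/2)) = √2 * τ ^ (-(1:ℝ)/2) := by
      have e : π/(π*τ/2) = 2 * τ⁻¹ := by field_simp
      rw [e, Real.sqrt_mul (by norm_num), Real.sqrt_eq_rpow τ⁻¹, Real.inv_rpow hτ.le,
        ← Real.rpow_neg hτ.le, neg_div]
    rw [this]
    apply le_of_eq; ring

lemma Ups_bound : ∃ C : ℝ, 0 ≤ C ∧ ∀ τ : ℝ, 0 < τ → τ ≤ 1 → ∀ n : ℕ, ∀ w : ℂ,
    -n ≤ w.re → w.re ≤ n + 1 → |w.im| * (n+1) ≤ 3 * τ →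
    ‖Upsilon w τ‖ ≤ C * (n + 1) * τ ^ (-(1:ℝ)/2) := by
  obtain ⟨C, hC, hb⟩ := Ups_base
  refine ⟨C + Real.exp (6*π), by positivity, fun τ hτ hτ1 n => ?_⟩
  have hp : 0 < τ ^ (-(1:ℝ)/2) := by positivity
  have hE := Real.exp_pos (6*π)
  induction n with
  | zero =>
    intro w h0 h1 h2
    simp at h0 h1 h2
    refine (hb τ hτ hτ1 w h0 h1 h2).trans ?_
    gcongr
    push_cast; nlinarith
  | succ n ih =>
    intro w h0 h1 h2
    push_cast at h0 h1 h2 ⊢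
    have h3 : |w.im| * (n+1) ≤ 3 * τ := by nlinarith [abs_nonneg w.im]
    have grow : ∀ z : ℂ, |z.re| ≤ n+1 → z.im = w.im →
        ‖Upsilon (z+1) τ - Upsilon z τ‖ ≤ τ ^ (-(1:ℝ)/2) * Real.exp (6*π) := by
      intro z hz hzi
      rw [Ups_rec τ hτ hτ1 z]
      gcongr
      have : -(2*π*z.re*z.im/τ) = 2*π*(-(z.re*z.im)/τ) := by ring
      rw [this]
      have h5 : -(z.re*z.im)/τ ≤ 3 := by
        rw [div_le_iff₀ hτ]
        refine (neg_le_abs _).trans ?_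
        rw [abs_mul, hzi]
        nlinarith [abs_nonneg w.im]
      nlinarith [Real.pi_pos]
    have fin : (C + Real.exp (6*π)) * (n+1) * τ ^ (-(1:ℝ)/2) + τ ^ (-(1:ℝ)/2) * Real.exp (6*π) ≤
       (C + Real.exp (6*π)) * (n+1+1) * τ ^ (-(1:ℝ)/2) := by
      nlinarith [mul_nonneg hC hp.le]
    rcases lt_or_ge (n+1:ℝ) w.re with h | h
    · have g := grow (w-1) (by simp; rw [abs_le]; constructor <;> linarith) (by simp)
      have i := ih (w-1) (by simp; linarith) (by simp; linarith) (by simpa using h3)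
      rw [sub_add_cancel] at g
      have := norm_sub_norm_le (Upsilon w τ) (Upsilon (w-1) τ)
      linarith
    · rcases lt_or_ge w.re (-n:ℝ) with h' | h'
      · have g := grow w (by rw [abs_le]; constructor <;> linarith) rfl
        have i := ih (w+1) (by simp; linarith) (by simp; linarith) (by simpa using h3)
        have := norm_sub_norm_le (Upsilon w τ) (Upsilon (w+1) τ)
        rw [norm_sub_rev] at this
        linarith
      · have := ih w h' h h3
        have : 0 ≤ τ ^ (-(1:ℝ)/2) * Real.exp (6*π) := by positivity
        linarith

theorem statement11 (k : ℕ) :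
    ∃ C : ℝ, ∀ u τ : ℝ, 0 < τ → τ ≤ 1 →
      τ ^ ((k:ℝ)/2) * ‖iteratedDeriv k (fun w : ℂ => Upsilon w (τ:ℂ)) (u:ℂ)‖ ≤
        C * τ ^ (-(1:ℝ)/2) * (1 + |u|) * (1 + (1 + |u|^k)/τ ^ ((k:ℝ)/2)) := by
  obtain ⟨C, hC, hb⟩ := Ups_bound
  refine ⟨k.factorial * C * 4 * 2^k, fun u τ hτ hτ1 => ?_⟩
  have hp : 0 < τ ^ (-(1:ℝ)/2) := by positivity
  have hq : 0 < τ ^ ((k:ℝ)/2) := by positivity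
  set a := 1 + |u| with ha
  have ha1 : 1 ≤ a := by simp [ha]
  have ha0 : 0 < a := by linarith
  have hr : 0 < τ / a := by positivity
  have hr1 : τ / a ≤ 1 := by rw [div_le_one ha0]; linarith
  have cau := Complex.norm_iteratedDeriv_le_of_forall_mem_sphere_norm_le (c := (u:ℂ)) (R := τ/a)
    (C := C * (4 * a) * τ ^ (-(1:ℝ)/2)) (f := fun w : ℂ => Upsilon w (τ:ℂ)) k hr
    (Ups_diff τ hτ hτ1).diffContOnCl (by
      intro z hz
      rw [mem_sphere_iff_norm] at hz
      have hre : |z.re - u| ≤ τ/a := by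
        rw [← hz]; simpa using Complex.abs_re_le_norm (z - u)
      have him : |z.im| ≤ τ/a := by
        rw [← hz]; simpa using Complex.abs_im_le_norm (z - u)
      rw [abs_le] at hre
      have hu1 := le_abs_self u
      have hu2 := neg_le_abs u
      set n := ⌈|u|⌉₊ with hn
      have hn1 : |u| ≤ n := Nat.le_ceil _
      have hn2 : (n:ℝ) < |u| + 1 := Nat.ceil_lt_add_one (abs_nonneg u)
      have := hb τ hτ hτ1 (n+1) z (by push_cast; linarith) (by push_cast; linarith) (by
        push_cast
        calc |z.im| * (n+1+1) ≤ τ/a * (3*a) := by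
              apply mul_le_mul him _ (by positivity) hr.le
              linarith
          _ = 3 * τ := by field_simp)
      refine this.trans ?_
      gcongr
      push_cast; linarith)
  have hk : a^k ≤ 2^k * (1 + |u|^k) := by
    rcases le_total |u| 1 with h | h
    · calc a^k ≤ 2^k := by gcongr; linarith
        _ ≤ _ := le_mul_of_one_le_right (by positivity) (by simp)
    · calc a^k ≤ (2*|u|)^k := by gcongr; linarith
        _ = 2^k * |u|^k := mul_pow _ _ _
        _ ≤ _ := by gcongr; linarith
  have hτk : τ^k = τ ^ ((k:ℝ)/2) * τ ^ ((k:ℝ)/2) := by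
    rw [← Real.rpow_add hτ, add_halves, Real.rpow_natCast]
  calc _ ≤ τ ^ ((k:ℝ)/2) * (k.factorial * (C * (4 * a) * τ ^ (-(1:ℝ)/2)) / (τ/a)^k) := by gcongr
    _ = (k.factorial * C * 4) * τ ^ (-(1:ℝ)/2) * a * (a^k / τ ^ ((k:ℝ)/2)) := by
      rw [div_pow, hτk]; field_simp
    _ ≤ (k.factorial * C * 4) * τ ^ (-(1:ℝ)/2) * a * (2^k * (1 + |u|^k) / τ ^ ((k:ℝ)/2)) := by gcongr
    _ = (k.factorial * C * 4 * 2^k) * τ ^ (-(1:ℝ)/2) * a * ((1 + |u|^k) / τ ^ ((k:ℝ)/2)) := by ring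
    _ ≤ _ := by gcongr; linarith

end
end

section
/- Let I ⊂ ℝ be a finite interval, N ∈ ℤ_{≥1}, and let L : ℂ ∖ (−∞,0] → ℂ be the holomorphic function with exp(L(s)) = Γ(s) for all s in this domain and L(1) = 0 (such L is unique). There is a constant C depending only on I and N such that for all s = σ + it with σ ∈ I and t ≠ 0, |L(s) − (s − 1/2)·log(it) + it − (1/2)·log(2π) + Σ_{k=1}^{N−1} (i/t)^k·B_{k+1}(σ)/(k(k+1))| ≤ C/|t|^N, where log(it) is the principal complex logarithm. -/
open Complex Real MeasureTheory

noncomputable section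

open Filter Topology

def lgMu (w : ℂ) : ℂ := (w + 1/2) * (Complex.log (w + 1) - Complex.log w) - 1

def lgG (w : ℂ) : ℂ := (w - 1/2) * Complex.log w - w

def lgM (w : ℂ) : ℂ := ∑' n : ℕ, lgMu (w + n)

lemma slit_add {w : ℂ} (hw : w ∈ slitPlane) {x : ℝ} (hx : 0 ≤ x) : w + x ∈ slitPlane := by
  rw [Complex.mem_slitPlane_iff] at *
  rcases hw with h | h
  · left; simp; linarith
  · right; simpa using h

lemma slit_add_nat {w : ℂ} (hw : w ∈ slitPlane) (n : ℕ) : w + n ∈ slitPlane := by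
  simpa using slit_add hw (x := n) (Nat.cast_nonneg n)

lemma slit_add_one {w : ℂ} (hw : w ∈ slitPlane) : w + 1 ∈ slitPlane := by
  simpa using slit_add_nat hw 1

lemma mu_bound {w : ℂ} (hw : w ∈ slitPlane) {r : ℝ} (hr : 0 < r)
    (h : ∀ u : ℝ, 0 ≤ u → u ≤ 1 → r ≤ ‖w + u‖) : ‖lgMu w‖ ≤ 1 / (4 * r^2) := by
  have hhalf : r ≤ ‖w + 1/2‖ := by
    have := h (1/2) (by norm_num) (by norm_num)
    simpa using this
  have hne : w + 1/2 ≠ 0 := by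
    intro h0; rw [h0] at hhalf; simp at hhalf; linarith
  have key := norm_image_sub_le_of_norm_deriv_le_segment_01'
    (f := fun u : ℝ => (w + 1/2) * Complex.log (w + u) - 2 * (u:ℂ) + (w * u + (u:ℂ)^2/2)/(w+1/2))
    (f' := fun u : ℝ => (w + 1/2) * (1 / (w + u)) - 2 * 1 + (w * 1 + 2 * (u:ℂ)^1 * 1/2)/(w+1/2))
    (C := 1 / (4 * r^2)) ?_ ?_
  · refine le_trans (le_of_eq ?_) key
    congr 1
    have e2 : (w * ((1:ℝ):ℂ) + ((1:ℝ):ℂ)^2/2)/(w+1/2) = 1 := by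
      rw [div_eq_one_iff_eq hne]; push_cast; ring
    simp only [e2, lgMu]
    push_cast
    ring_nf
  · intro x hx
    apply HasDerivAt.hasDerivWithinAt
    have h1 : HasDerivAt (fun u : ℝ => (u:ℂ)) 1 x := Complex.ofRealCLM.hasDerivAt
    have h2 : HasDerivAt (fun u : ℝ => Complex.log (w + u)) (1 / (w + x)) x :=
      (h1.const_add w).clog_real (slit_add hw hx.1)
    have h3 := (h1.pow 2).div_const 2
    exact ((h2.const_mul (w+1/2)).sub (h1.const_mul 2)).add
      (((h1.const_mul w).add (by simpa using h3)).div_const (w+1/2))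
  · intro x hx
    have hx0 := h x hx.1 hx.2.le
    have hne2 : w + x ≠ 0 := slitPlane_ne_zero (slit_add hw hx.1)
    have e : (w + 1/2) * (1 / (w + x)) - 2 * 1 + (w * 1 + 2 * (x:ℂ)^1 * 1/2)/(w+1/2)
        = (((1/2 - x)^2 : ℝ) : ℂ) / ((w + x) * (w + 1/2)) := by
      have hne3 : (w + x) * (w + 1/2) ≠ 0 := mul_ne_zero hne2 hne
      rw [eq_div_iff hne3]
      have q1 : (1 / (w + x)) * (w + x) = 1 := by field_simp
      have q2 : (w * 1 + 2 * (x:ℂ)^1 * 1/2)/(w+1/2) * (w + 1/2) = w + x := by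
        rw [div_mul_cancel₀ _ hne]; ring
      push_cast
      linear_combination (w+1/2)^2 * q1 + (w + x) * q2
    rw [e, norm_div, norm_mul, Complex.norm_real, Real.norm_eq_abs, abs_of_nonneg (sq_nonneg _)]
    have : (1/2 - x)^2 ≤ 1/4 := by nlinarith [hx.1, hx.2]
    calc (1/2 - x)^2 / (‖w + x‖ * ‖w + 1/2‖) ≤ (1/4) / (r * r) := by gcongr
      _ = 1 / (4 * r^2) := by field_simp

lemma summ_inv : Summable (fun n : ℕ => 1 / (((n:ℝ)+1)^2)) := by
  have := (summable_nat_add_iff 1).mpr (Real.summable_one_div_nat_pow.mpr (by norm_num : 1 < 2))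
  simpa using this

lemma mu_bound_right {w : ℂ} (hw : 0 < w.re) (n : ℕ) :
    ‖lgMu (w + 1 + n)‖ ≤ 1/4 * (1 / ((n:ℝ)+1)^2) := by
  have := mu_bound (w := w + 1 + n) (r := n+1) (by left; simp; positivity) (by positivity) ?_
  · refine this.trans (le_of_eq ?_)
    field_simp
  · intro u hu _
    refine le_trans ?_ (Complex.re_le_norm _)
    simp; linarith

lemma mu_bound_sector {w : ℂ} {κ : ℝ} (hκ : 0 ≤ κ) (h1 : 1 ≤ |w.im|) (h2 : ‖w‖ ≤ κ * |w.im|)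
    (n : ℕ) : ‖lgMu (w + n)‖ ≤ (κ+2)^2/4 * (1 / ((n:ℝ)+1)^2) := by
  have hs : w ∈ slitPlane := by right; intro h; rw [h] at h1; norm_num at h1
  have := mu_bound (w := w + n) (r := (n+1)/(κ+2)) (slit_add_nat hs n) (by positivity) ?_
  · refine this.trans (le_of_eq ?_)
    field_simp
  · intro u hu _
    have a1 : |w.im| ≤ ‖w + n + u‖ := by
      have := Complex.abs_im_le_norm (w + n + u); simpa using this
    have a2 : (n:ℝ) ≤ ‖w + n + u‖ + ‖w‖ := by
      have : ‖((n + u : ℝ) : ℂ)‖ ≤ ‖w + n + u‖ + ‖w‖ := by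
        have e : ((n + u : ℝ) : ℂ) = (w + n + u) - w := by push_cast; ring
        rw [e]; exact norm_sub_le _ _
      rw [Complex.norm_real, Real.norm_eq_abs, abs_of_nonneg (by positivity)] at this
      linarith
    rw [div_le_iff₀ (by positivity)]
    nlinarith [mul_le_mul_of_nonneg_left a1 hκ]

lemma mu_bound_shift {w : ℂ} {m : ℕ} (hm : -(m:ℝ) < w.re) (n : ℕ) :
    ‖lgMu (w + (n + (m + 1) : ℕ))‖ ≤ 1/4 * (1 / ((n:ℝ)+1)^2) := by
  have := mu_bound_right (w := w + m) (by simp; linarith) n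
  convert this using 3
  push_cast; ring

lemma mu_summable (w : ℂ) : Summable (fun n : ℕ => lgMu (w + n)) := by
  obtain ⟨m, hm⟩ := exists_nat_gt (-w.re)
  rw [← summable_nat_add_iff (m+1)]
  exact Summable.of_norm_bounded (summ_inv.mul_left (1/4))
    (fun n => mu_bound_shift (m := m) (by linarith) n)

lemma mu_cont {w : ℂ} (hw : w ∈ slitPlane) : ContinuousAt lgMu w := by
  unfold lgMu
  have h1 := slit_add_one hw
  fun_prop (disch := assumption)

lemma lgM_cont : ContinuousOn lgM slitPlane := by
  intro w hw
  apply ContinuousAt.continuousWithinAt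
  obtain ⟨m, hm⟩ := exists_nat_gt (-w.re)
  have e : lgM = fun w => (∑ n ∈ Finset.range (m+1), lgMu (w + n))
      + ∑' n : ℕ, lgMu (w + (n + (m + 1) : ℕ)) := by
    funext w
    exact ((mu_summable w).sum_add_tsum_nat_add (m+1)).symm
  have hopen : IsOpen (slitPlane ∩ {w : ℂ | -(m:ℝ) < w.re}) :=
    Complex.isOpen_slitPlane.inter (isOpen_lt continuous_const Complex.continuous_re)
  have hterm : ∀ n : ℕ, ContinuousOn (fun w => lgMu (w + n)) slitPlane := by
    intro n z hz
    apply ContinuousAt.continuousWithinAt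
    exact ContinuousAt.comp (f := fun w => w + (n:ℂ)) (mu_cont (slit_add_nat hz n)) (by fun_prop)
  have hc : ContinuousOn lgM (slitPlane ∩ {w : ℂ | -(m:ℝ) < w.re}) := by
    rw [e]
    apply ContinuousOn.add
    · exact continuousOn_finsetSum _ (fun n _ => (hterm n).mono Set.inter_subset_left)
    · apply continuousOn_tsum (u := fun n : ℕ => 1/4 * (1 / ((n:ℝ)+1)^2))
      · intro n; exact (hterm _).mono Set.inter_subset_left
      · exact summ_inv.mul_left (1/4)
      · intro n x hx; exact mu_bound_shift hx.2 n
  exact hc.continuousAt (hopen.mem_nhds ⟨hw, by simp; linarith⟩)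

lemma lgM_bound {w : ℂ} {κ : ℝ} (hκ : 0 ≤ κ) (h1 : 1 ≤ |w.im|) (h2 : ‖w‖ ≤ κ * |w.im|) :
    ‖lgM w‖ ≤ (κ+2)^2/4 * ∑' n : ℕ, (1 / ((n:ℝ)+1)^2) := by
  rw [← tsum_mul_left]
  exact tsum_of_norm_bounded (summ_inv.mul_left _).hasSum (mu_bound_sector hκ h1 h2)

lemma lgM_partial (w : ℂ) (m : ℕ) : ∑ n ∈ Finset.range m, lgMu (w + n)
    = lgG (w + m) - lgG w - ∑ n ∈ Finset.range m, Complex.log (w + n) := by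
  induction m with
  | zero => simp
  | succ m ih =>
    rw [Finset.sum_range_succ, Finset.sum_range_succ, ih]
    simp only [lgMu, lgG]
    push_cast
    rw [show w + ((m:ℂ) + 1) = w + m + 1 by ring]
    ring

lemma lgM_succ (w : ℂ) : lgG (w + 1) + lgM (w + 1) = lgG w + lgM w + Complex.log w := by
  have h := (mu_summable w).sum_add_tsum_nat_add 1
  rw [lgM_partial] at h
  simp only [Finset.range_one, Finset.sum_singleton, Nat.cast_zero, add_zero, Nat.cast_one] at h
  have e : lgM (w+1) = ∑' i : ℕ, lgMu (w + ((i + 1 : ℕ) : ℂ)) := by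
    unfold lgM; congr 1; funext n; congr 1; push_cast; ring
  rw [e]
  unfold lgM
  rw [← h]; ring

lemma lgM_tendsto {ι : Type*} {l : Filter ι} {t : ι → ℝ} (ht : Tendsto (fun i => |t i|) l atTop) :
    Tendsto (fun i => lgM (t i * I)) l (𝓝 0) := by
  have := tendsto_tsum_of_dominated_convergence (𝓕 := l) (f := fun i (n:ℕ) => lgMu (t i * I + n))
    (g := fun _ => 0) (bound := fun n : ℕ => (1+2)^2/4 * (1 / ((n:ℝ)+1)^2))
    (summ_inv.mul_left _) ?_ ?_
  · simpa [lgM] using this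
  · intro n
    rw [tendsto_zero_iff_norm_tendsto_zero]
    have h0 : Tendsto (fun i => 1 / (4 * |t i|^2)) l (𝓝 0) := by
      have : Tendsto (fun x : ℝ => 1 / (4 * x^2)) atTop (𝓝 0) := by
        simp only [one_div]
        apply Tendsto.inv_tendsto_atTop
        exact Tendsto.const_mul_atTop (by norm_num) (tendsto_pow_atTop (by norm_num))
      exact this.comp ht
    refine tendsto_of_tendsto_of_tendsto_of_le_of_le' tendsto_const_nhds h0
      (Eventually.of_forall fun _ => norm_nonneg _) ?_
    filter_upwards [ht.eventually_ge_atTop 1] with i hi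
    apply mu_bound
    · right; simp; intro h; rw [h] at hi; norm_num at hi
    · linarith
    · intro u _ _
      have := Complex.abs_im_le_norm (t i * I + n + u); simpa using this
  · filter_upwards [ht.eventually_ge_atTop 1] with i hi n
    apply mu_bound_sector (by norm_num)
    · simpa using hi
    · simp

lemma fact_stirling (m : ℕ) (hm : 1 ≤ m) : ((m.factorial : ℝ) : ℂ)
    = Stirling.stirlingSeq m * (√2 : ℝ) *
      Complex.exp ((Real.log m : ℝ)/2 + (m * (Real.log m : ℝ) - m)) := by
  have hm' : (0:ℝ) < m := by exact_mod_cast hm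
  have h1 : (m.factorial : ℝ) = Stirling.stirlingSeq m * √2 *
      Real.exp (Real.log m/2 + (m * Real.log m - m)) := by
    have e1 : √(2 * m : ℝ) = √2 * Real.exp (Real.log m / 2) := by
      rw [Real.sqrt_mul (by norm_num), Real.exp_half, Real.exp_log hm']
    have e2 : ((m:ℝ) / Real.exp 1)^m = Real.exp (m * Real.log m - m) := by
      rw [div_pow, Real.exp_sub, Real.exp_one_pow, mul_comm, Real.exp_mul, Real.exp_log hm']
      simp
    have hne : √(2 * m : ℝ) * ((m:ℝ) / Real.exp 1)^m ≠ 0 := by positivity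
    rw [Real.exp_add, ← e2]
    rw [show Stirling.stirlingSeq m * √2 * (Real.exp (Real.log m / 2) * ((m:ℝ) / Real.exp 1)^m)
      = Stirling.stirlingSeq m * ((√2 * Real.exp (Real.log m / 2)) * ((m:ℝ) / Real.exp 1)^m) by ring,
      ← e1]
    rw [Stirling.stirlingSeq, div_mul_cancel₀ _ hne]
  rw [h1]
  push_cast
  rfl

lemma exp_lg (s : ℂ) (hs : s ∈ slitPlane) :
    Complex.exp (lgG s + lgM s + (Real.log (2*π) : ℂ)/2) = Complex.Gamma s := by
  have hA : Tendsto (fun m : ℕ => Complex.exp (lgG s + ∑ n ∈ Finset.range m, lgMu (s + n))) atTop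
      (𝓝 (Complex.exp (lgG s + lgM s))) := by
    apply (Complex.continuous_exp.tendsto _).comp
    exact tendsto_const_nhds.add (mu_summable s).hasSum.tendsto_sum_nat
  have hlog : Tendsto (fun m : ℕ => (m:ℂ) * Complex.log (1 + s / m)) atTop (𝓝 s) := by
    apply Complex.tendsto_nat_mul_log_one_add_of_tendsto
    refine tendsto_const_nhds.congr' ?_
    filter_upwards [eventually_ge_atTop 1] with m hm
    have : (m:ℂ) ≠ 0 := by exact_mod_cast (by omega : m ≠ 0)
    field_simp
  have hdiv : Tendsto (fun m : ℕ => s / (m:ℂ)) atTop (𝓝 0) :=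
    tendsto_const_div_atTop_nhds_zero_nat s
  have hlog0 : Tendsto (fun m : ℕ => Complex.log (1 + s / m)) atTop (𝓝 0) := by
    have h : ContinuousAt Complex.log 1 := continuousAt_clog (by simp)
    have := h.tendsto.comp (show Tendsto (fun m : ℕ => 1 + s / (m:ℂ)) atTop (𝓝 1) by
      simpa using hdiv.const_add 1)
    simpa [Function.comp_def] using this
  have hE : Tendsto (fun m : ℕ => (s + m + 1/2) * Complex.log (1 + s / m) - s) atTop (𝓝 0) := by
    have := ((hlog0.const_mul (s+1/2)).add hlog).sub_const s
    simp only [mul_zero, zero_add, sub_self] at this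
    refine this.congr fun m => ?_
    ring
  have hst : Tendsto (fun m : ℕ => ((Stirling.stirlingSeq m : ℝ) : ℂ) * (√2 : ℝ)) atTop
      (𝓝 ((√π : ℝ) * (√2 : ℝ))) :=
    ((Complex.continuous_ofReal.tendsto _).comp Stirling.tendsto_stirlingSeq_sqrt_pi).mul_const _
  have hpos : ((√π : ℝ) * (√2 : ℝ) : ℂ) ≠ 0 := by
    have : (√π : ℝ) * √2 ≠ 0 := by positivity
    exact_mod_cast this
  have hB : Tendsto (fun m : ℕ => Complex.exp ((s + m + 1/2) * Complex.log (1 + s / m) - s) /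
      (((Stirling.stirlingSeq m : ℝ) : ℂ) * (√2 : ℝ)) * Complex.GammaSeq s m) atTop
      (𝓝 (Complex.exp 0 / ((√π : ℝ) * (√2 : ℝ)) * Complex.Gamma s)) :=
    (((Complex.continuous_exp.tendsto _).comp hE).div hst hpos).mul
      (Complex.GammaSeq_tendsto_Gamma s)
  have hAB := tendsto_nhds_unique (hA.congr' ?_) hB
  · rw [Complex.exp_add, hAB]
    have : Complex.exp ((Real.log (2*π) : ℂ)/2) = (√π : ℝ) * (√2 : ℝ) := by
      rw [show (Real.log (2*π) : ℂ)/2 = ((Real.log (2*π)/2 : ℝ) : ℂ) by push_cast; rfl,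
        ← Complex.ofReal_exp, Real.exp_half, Real.exp_log (by positivity),
        Real.sqrt_mul (by norm_num)]
      push_cast; ring
    rw [this, Complex.exp_zero]
    field_simp
  · filter_upwards [eventually_ge_atTop 1, hst.eventually_ne hpos] with m hm hstm
    have hm' : (0:ℝ) < m := by exact_mod_cast hm
    have hmc : (m:ℂ) ≠ 0 := by exact_mod_cast hm'.ne'
    have hsm : s + m ≠ 0 := slitPlane_ne_zero (slit_add_nat hs m)
    have hne1 : 1 + s/m ≠ 0 := by
      intro h0
      apply hsm
      have : s + m = m * (1 + s/m) := by field_simp; ring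
      rw [this, h0, mul_zero]
    have hl : Complex.log (s + m) = (Real.log m : ℝ) + Complex.log (1 + s/m) := by
      rw [← Complex.log_ofReal_mul hm' hne1]
      congr 1; push_cast; field_simp; ring
    have hprod : ∀ k : ℕ, Complex.exp (∑ n ∈ Finset.range k, Complex.log (s + n))
        = ∏ n ∈ Finset.range k, (s + n) := by
      intro k
      rw [Complex.exp_sum]
      exact Finset.prod_congr rfl fun n _ =>
        Complex.exp_log (slitPlane_ne_zero (slit_add_nat hs n))
    have hmp : (m:ℂ)^s = Complex.exp ((Real.log m : ℝ) * s) := by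
      rw [Complex.cpow_def_of_ne_zero hmc, Complex.natCast_log]
    have hf := fact_stirling m hm
    rw [Complex.ofReal_natCast] at hf
    rw [lgM_partial, Complex.GammaSeq, ← hprod, Finset.sum_range_succ, hf, hmp]
    rw [div_mul_div_comm, eq_div_iff (mul_ne_zero hstm (Complex.exp_ne_zero _))]
    set S := ∑ n ∈ Finset.range m, Complex.log (s + n)
    set T := ((Stirling.stirlingSeq m : ℝ) : ℂ) * (√2 : ℝ)
    rw [show ∀ a b d : ℂ, a * (b * (T * d)) = T * (a * b * d) by intros; ring,
      show ∀ a b : ℂ, a * (T * b) = T * (a * b) by intros; ring]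
    rw [← Complex.exp_add, ← Complex.exp_add, ← Complex.exp_add]
    congr 2
    simp only [lgG, hl]
    ring

lemma GammaOmega_eq : GammaOmega = slitPlane := by
  ext s; simp [GammaOmega, Complex.mem_slitPlane_iff, or_comm]

lemma mu_im (n : ℕ) : (lgMu (1 + n)).im = 0 := by
  have : lgMu (1 + n) = (((1 + n : ℝ) + 1/2) * (Real.log ((1 + n : ℝ) + 1) - Real.log (1+n:ℝ)) - 1 : ℝ) := by
    unfold lgMu
    push_cast
    rw [Complex.ofReal_log (by positivity), Complex.ofReal_log (by positivity)]
    push_cast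
    rfl
  rw [this, Complex.ofReal_im]

lemma lg_one : lgG 1 + lgM 1 + (Real.log (2*π) : ℂ)/2 = 0 := by
  have h1 : (lgM 1).im = 0 := by
    unfold lgM
    rw [Complex.im_tsum (mu_summable 1)]
    simp [mu_im]
  have h2 : (lgG 1 + lgM 1 + (Real.log (2*π) : ℂ)/2).im = 0 := by
    rw [show (Real.log (2*π) : ℂ)/2 = ((Real.log (2*π)/2 : ℝ) : ℂ) by push_cast; rfl]
    simp only [Complex.add_im, Complex.ofReal_im, h1]
    simp [lgG]
  have h3 := exp_lg 1 (by simp)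
  rw [Complex.Gamma_one] at h3
  set F := lgG 1 + lgM 1 + (Real.log (2*π) : ℂ)/2
  have h4 : F = (F.re : ℂ) := by apply Complex.ext <;> simp [h2]
  rw [h4] at h3 ⊢
  rw [← Complex.ofReal_exp] at h3
  have h5 : Real.exp F.re = 1 := by exact_mod_cast h3
  rw [Real.exp_eq_one_iff] at h5
  simp [h5]

lemma L_eq {L : ℂ → ℂ} (hL : IsLogGamma L) {s : ℂ} (hs : s ∈ slitPlane) :
    L s = lgG s + lgM s + (Real.log (2*π) : ℂ)/2 := by
  obtain ⟨hd, he, h1⟩ := hL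
  rw [GammaOmega_eq] at hd he
  set g : ℂ → ℂ := fun s => L s - (lgG s + lgM s + (Real.log (2*π) : ℂ)/2) with hg
  have hgc : ContinuousOn g slitPlane := by
    apply hd.continuousOn.sub
    apply ContinuousOn.add _ continuousOn_const
    apply ContinuousOn.add _ lgM_cont
    intro w hw
    apply ContinuousAt.continuousWithinAt
    unfold lgG
    fun_prop (disch := assumption)
  have hge : ∀ w ∈ slitPlane, ∃ n : ℤ, g w = n * (2 * π * I) := by
    intro w hw
    have : Complex.exp (g w) = 1 := by
      rw [hg]; simp only
      rw [Complex.exp_sub, he w hw, exp_lg w hw, div_self]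
      rw [← he w hw]; exact Complex.exp_ne_zero _
    exact Complex.exp_eq_one_iff.mp this
  have hpre : IsPreconnected slitPlane :=
    ((starConvex_one_slitPlane).isPathConnected (by simp)).isConnected.isPreconnected
  have hg1 : g 1 = 0 := by rw [hg]; simp only; rw [lg_one, h1, sub_zero]
  have him : ∀ w (n : ℤ), g w = n * (2 * π * I) → (g w).im / (2*π) = n := by
    intro w n h
    rw [h]; simp
  have hgs : g s = 0 := by
    obtain ⟨n, hn⟩ := hge s hs
    have hr : ContinuousOn (fun w => (g w).im / (2*π)) slitPlane :=
      (Complex.continuous_im.comp_continuousOn hgc).div_const _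
    have hord := (hpre.image _ hr).ordConnected
    have m1 : (0:ℝ) ∈ (fun w => (g w).im / (2*π)) '' slitPlane := ⟨1, by simp, by simp [hg1]⟩
    have m2 : (n:ℝ) ∈ (fun w => (g w).im / (2*π)) '' slitPlane := ⟨s, hs, him s n hn⟩
    have key : (1/2 : ℝ) ∉ (fun w => (g w).im / (2*π)) '' slitPlane := by
      rintro ⟨w, hw, hw2⟩
      obtain ⟨k, hk⟩ := hge w hw
      simp only at hw2
      rw [him w k hk] at hw2
      have : (2 * k : ℝ) = 1 := by linarith
      have : 2 * k = 1 := by exact_mod_cast this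
      omega
    have key' : (-1/2 : ℝ) ∉ (fun w => (g w).im / (2*π)) '' slitPlane := by
      rintro ⟨w, hw, hw2⟩
      obtain ⟨k, hk⟩ := hge w hw
      simp only at hw2
      rw [him w k hk] at hw2
      have : (2 * k : ℝ) = -1 := by linarith
      have : 2 * k = -1 := by exact_mod_cast this
      omega
    rcases lt_trichotomy n 0 with h | h | h
    · exfalso; apply key'
      have : (n:ℝ) ≤ -1 := by exact_mod_cast (by omega : n ≤ -1)
      exact hord.out m2 m1 ⟨by linarith, by norm_num⟩
    · rw [hn, h]; simp
    · exfalso; apply key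
      have : (1:ℝ) ≤ n := by exact_mod_cast (by omega : 1 ≤ n)
      exact hord.out m1 m2 ⟨by norm_num, by linarith⟩
  exact sub_eq_zero.mp hgs

lemma L_succ {L : ℂ → ℂ} (hL : IsLogGamma L) {s : ℂ} (hs : s ∈ slitPlane) :
    L (s + 1) = L s + Complex.log s := by
  rw [L_eq hL hs, L_eq hL (slit_add_one hs)]
  linear_combination lgM_succ s

lemma L_add {L : ℂ → ℂ} (hL : IsLogGamma L) {s : ℂ} (hs : s ∈ slitPlane) (m : ℕ) :
    L (s + m) = L s + ∑ n ∈ Finset.range m, Complex.log (s + n) := by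
  induction m with
  | zero => simp
  | succ m ih =>
    rw [Finset.sum_range_succ, ← add_assoc, ← ih, ← L_succ hL (slit_add_nat hs m)]
    congr 1; push_cast; ring

def bb (k : ℕ) (a : ℝ) : ℂ := (bernoulliFun k a : ℂ) / (k.factorial : ℂ)

lemma bb_deriv (k : ℕ) (a : ℝ) : HasDerivAt (bb (k+1)) (bb k a) a := by
  have h := ((hasDerivAt_bernoulliFun (k+1) a).ofReal_comp).div_const ((k+1).factorial : ℂ)
  refine HasDerivAt.congr_deriv h ?_
  simp only [bb, Nat.factorial_succ, Nat.add_sub_cancel]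
  have : (k.factorial : ℂ) ≠ 0 := by exact_mod_cast k.factorial_ne_zero
  have h2 : (k + 1 : ℂ) ≠ 0 := by exact_mod_cast k.succ_ne_zero
  push_cast
  field_simp

lemma bb_int (k : ℕ) : ∫ x in (0:ℝ)..1, bb (k+1) x = 0 := by
  simp only [bb]
  rw [intervalIntegral.integral_div, intervalIntegral.integral_ofReal, integral_bernoulliFun]
  simp

lemma bb_cont (k : ℕ) : Continuous (bb k) := by
  unfold bb
  have := continuous_bernoulliFun k
  fun_prop

lemma mean_zero_bound {F F' : ℝ → ℂ} {K ε : ℝ} (hK : 1 ≤ K) (hF : ∀ a, HasDerivAt F (F' a) a)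
    (hb : ∀ a, |a| ≤ K → ‖F' a‖ ≤ ε) (h0 : ∫ x in (0:ℝ)..1, F x = 0) (a : ℝ) (ha : |a| ≤ K) :
    ‖F a‖ ≤ 2 * K * ε := by
  have hε : 0 ≤ ε := (norm_nonneg _).trans (hb a ha)
  have hc : Continuous F := continuous_iff_continuousAt.mpr fun x => (hF x).continuousAt
  have e : F a = ∫ x in (0:ℝ)..1, (F a - F x) := by
    rw [intervalIntegral.integral_sub (by simp) (hc.intervalIntegrable _ _), h0]
    simp
  rw [e]
  have := intervalIntegral.norm_integral_le_of_norm_le_const (a := (0:ℝ)) (b := 1)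
    (f := fun x => F a - F x) (C := 2 * K * ε) ?_
  · simpa using this
  · intro x hx
    rw [Set.uIoc_of_le zero_le_one] at hx
    have hx' : x ∈ Set.Icc (-K) K := ⟨by linarith [hx.1], by linarith [hx.2]⟩
    have := (convex_Icc (-K) K).norm_image_sub_le_of_norm_hasDerivWithin_le (f := F) (f' := F')
      (C := ε) (fun y _ => (hF y).hasDerivWithinAt) (fun y hy => hb y (abs_le.mpr hy))
      hx' (abs_le.mp ha)
    refine this.trans ?_
    have h2 : ‖a - x‖ ≤ 2 * K := by
      rw [Real.norm_eq_abs, abs_le]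
      have := abs_le.mp ha
      constructor <;> linarith [hx'.1, hx'.2]
    nlinarith

lemma emac {K : ℝ} (hK : 1 ≤ K) (N : ℕ) : ∀ (H : ℕ → ℝ → ℂ)
    (_ : ∀ j a, HasDerivAt (H j) (H (j+1) a) a) (ε : ℝ)
    (_ : ∀ a, |a| ≤ K → ‖H (N+1) a‖ ≤ ε) (a : ℝ) (_ : |a| ≤ K),
    ‖H 0 a - (∫ x in (0:ℝ)..1, H 0 x) - ∑ k ∈ Finset.range N, (H k 1 - H k 0) * bb (k+1) a‖
      ≤ (2*K)^(N+1) * ε := by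
  induction N with
  | zero =>
    intro H hH ε hb a ha
    have hc : Continuous (H 0) := continuous_iff_continuousAt.mpr fun x => (hH 0 x).continuousAt
    have := mean_zero_bound (F := fun x => H 0 x - ∫ x in (0:ℝ)..1, H 0 x) (F' := H 1) hK
      (fun x => (hH 0 x).sub_const _) hb (by
        rw [intervalIntegral.integral_sub (hc.intervalIntegrable _ _) (by simp)]; simp) a ha
    simpa using this
  | succ N ih =>
    intro H hH ε hb a ha
    have hc : ∀ j, Continuous (H j) :=
      fun j => continuous_iff_continuousAt.mpr fun x => (hH j x).continuousAt
    have ih' := ih (fun j => H (j+1)) (fun j => hH (j+1)) ε hb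
    have hint : ∫ x in (0:ℝ)..1, H 1 x = H 0 1 - H 0 0 :=
      intervalIntegral.integral_eq_sub_of_hasDerivAt (fun x _ => hH 0 x)
        ((hc 1).intervalIntegrable _ _)
    have := mean_zero_bound (K := K) (ε := (2*K)^(N+1) * ε)
      (F := fun x => H 0 x - (∫ x in (0:ℝ)..1, H 0 x)
        - ∑ k ∈ Finset.range (N+1), (H k 1 - H k 0) * bb (k+1) x)
      (F' := fun x => H 1 x - ∑ k ∈ Finset.range (N+1), (H k 1 - H k 0) * bb k x) hK ?_ ?_ ?_ a ha
    · refine this.trans (le_of_eq ?_); ring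
    · intro x
      exact ((hH 0 x).sub_const _).sub
        (HasDerivAt.fun_sum fun k _ => (bb_deriv k x).const_mul _)
    · intro x hx
      refine le_trans (le_of_eq ?_) (ih' x hx)
      congr 1
      simp only [zero_add, hint]
      rw [Finset.sum_range_succ']
      simp [bb]
      ring
    · rw [intervalIntegral.integral_sub, intervalIntegral.integral_sub,
        intervalIntegral.integral_finsetSum]
      · simp [bb_int]
      · intro k _
        exact ((bb_cont _).const_mul _).intervalIntegrable _ _
      · exact (hc 0).intervalIntegrable _ _
      · simp
      · exact ((hc 0).sub continuous_const).intervalIntegrable _ _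
      · exact (continuous_finsetSum _ fun k _ => (bb_cont _).const_mul _).intervalIntegrable _ _

lemma log_diff {s w : ℂ} {t : ℝ} (ht : s.im = t) (h0 : t ≠ 0) (hw : ‖w - s‖ ≤ |t|/2) :
    ‖Complex.log w - Complex.log s‖ ≤ 1 := by
  have hpos : 0 < |t| := abs_pos.mpr h0
  have him : ∀ z ∈ Metric.closedBall s (|t|/2), |t|/2 ≤ |z.im| := by
    intro z hz
    rw [Metric.mem_closedBall, dist_eq_norm] at hz
    have h1 := (Complex.abs_im_le_norm (z - s)).trans hz
    rw [Complex.sub_im, ht] at h1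
    have := abs_sub_abs_le_abs_sub t z.im
    rw [abs_sub_comm] at this
    linarith
  have hsl : ∀ z ∈ Metric.closedBall s (|t|/2), z ∈ slitPlane := by
    intro z hz
    right
    intro h; have := him z hz; rw [h] at this; simp at this; linarith
  have := (convex_closedBall s (|t|/2)).norm_image_sub_le_of_norm_hasDerivWithin_le
    (f := Complex.log) (f' := fun z => z⁻¹) (C := 2/|t|)
    (fun z hz => (Complex.hasDerivAt_log (hsl z hz)).hasDerivWithinAt) ?_
    (x := s) (y := w) (by simp; positivity) (by rwa [Metric.mem_closedBall, dist_eq_norm])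
  · refine this.trans ?_
    calc 2/|t| * ‖w - s‖ ≤ 2/|t| * (|t|/2) := by gcongr
      _ = 1 := by field_simp
  · intro z hz
    rw [norm_inv, show 2/|t| = (|t|/2)⁻¹ by field_simp]
    gcongr
    exact (him z hz).trans (Complex.abs_im_le_norm z)

lemma L_an {L : ℂ → ℂ} (hL : IsLogGamma L) {s : ℂ} (hs : s ∈ slitPlane) : AnalyticAt ℂ L s := by
  have := hL.1
  rw [GammaOmega_eq] at this
  exact this.analyticAt (Complex.isOpen_slitPlane.mem_nhds hs)

lemma iter_affine (n : ℕ) (b c s : ℂ) :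
    iteratedDeriv (n+2) (fun w : ℂ => (w - 1/2) * b - w + c) s = 0 := by
  have h1 : deriv (fun w : ℂ => (w - 1/2) * b - w + c) = fun _ => b - 1 := by
    funext w
    have : HasDerivAt (fun w : ℂ => (w - 1/2) * b - w + c) (1 * b - 1) w :=
      ((((hasDerivAt_id w).sub_const (1/2)).mul_const b).sub (hasDerivAt_id w)).add_const c
    rw [this.deriv, one_mul]
  rw [iteratedDeriv_succ', h1, iteratedDeriv_succ']
  simp

lemma L_deriv_bound {L : ℂ → ℂ} (hL : IsLogGamma L) (K : ℝ) (N : ℕ) (hN : 1 ≤ N) :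
    ∃ C : ℝ, ∀ t a : ℝ, 2 ≤ |t| → 2 * K ≤ |t| → |a| ≤ K →
      ‖iteratedDeriv (N+1) L (t * I + a)‖ ≤ C / |t|^N := by
  set CM : ℝ := ((4:ℝ)+2)^2/4 * ∑' n : ℕ, (1 / ((n:ℝ)+1)^2) with hCM
  refine ⟨(N+1).factorial * (3 + CM) * 2^(N+1), ?_⟩
  intro t a h2 hK ha
  have hpos : 0 < |t| := by linarith
  have h0 : t ≠ 0 := abs_pos.mp hpos
  set s : ℂ := t * I + a with hs
  have him : s.im = t := by simp [hs]
  have hsn : ‖s‖ ≤ |t| + K := by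
    rw [hs]; refine (norm_add_le _ _).trans ?_
    simp; exact ha
  have himw : ∀ z ∈ Metric.closedBall s (|t|/2), |t|/2 ≤ |z.im| := by
    intro z hz
    rw [Metric.mem_closedBall, dist_eq_norm] at hz
    have h1 := (Complex.abs_im_le_norm (z - s)).trans hz
    rw [Complex.sub_im, him] at h1
    have := abs_sub_abs_le_abs_sub t z.im
    rw [abs_sub_comm] at this
    linarith
  have hsl : ∀ z ∈ Metric.closedBall s (|t|/2), z ∈ slitPlane := by
    intro z hz
    right
    intro h; have := himw z hz; rw [h] at this; simp at this; linarith
  set c : ℂ := (Real.log (2*π) : ℂ)/2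
  set g : ℂ → ℂ := L - fun w => (w - 1/2) * Complex.log s - w + c with hg
  have hga : ∀ z ∈ Metric.closedBall s (|t|/2), DifferentiableAt ℂ g z := by
    intro z hz
    apply (L_an hL (hsl z hz)).differentiableAt.sub
    fun_prop
  have hss : s ∈ Metric.closedBall s (|t|/2) := Metric.mem_closedBall_self (by positivity)
  have hLg : iteratedDeriv (N+1) L s = iteratedDeriv (N+1) g s := by
    obtain ⟨n, rfl⟩ : ∃ n, N = n + 1 := ⟨N - 1, by omega⟩
    rw [hg, iteratedDeriv_sub (L_an hL (hsl s hss)).contDiffAt (by fun_prop), iter_affine, sub_zero]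
  rw [hLg]
  have hcau := Complex.norm_iteratedDeriv_le_of_forall_mem_sphere_norm_le (N+1) (f := g) (c := s)
    (R := |t|/2) (C := (3 + CM) * |t|) (by positivity) ?_ ?_
  · refine hcau.trans (le_of_eq ?_)
    rw [div_pow, pow_succ |t| N]
    field_simp
  · apply DifferentiableOn.diffContOnCl
    intro z hz
    exact (hga z (Metric.closure_ball_subset_closedBall hz)).differentiableWithinAt
  · intro w hw
    have hwb := Metric.sphere_subset_closedBall hw
    have hd : ‖w - s‖ ≤ |t|/2 := by rwa [Metric.mem_closedBall, dist_eq_norm] at hwb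
    have hwi := himw w hwb
    have hwn : ‖w‖ ≤ 2 * |t| := by
      have : ‖w‖ ≤ ‖w - s‖ + ‖s‖ := by simpa using norm_add_le (w - s) s
      linarith
    have hMb : ‖lgM w‖ ≤ CM := lgM_bound (κ := 4) (by norm_num) (by linarith) (by linarith)
    have e : g w = (w - 1/2) * (Complex.log w - Complex.log s) + lgM w := by
      simp only [hg, Pi.sub_apply]
      rw [L_eq hL (hsl w hwb), lgG]; ring
    rw [e]
    have hl := log_diff him h0 hd
    have hw2 : ‖w - 1/2‖ ≤ 3 * |t| := by
      refine (norm_sub_le _ _).trans ?_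
      norm_num
      linarith
    have hCM0 : 0 ≤ CM := (norm_nonneg _).trans hMb
    calc _ ≤ ‖w - 1/2‖ * ‖Complex.log w - Complex.log s‖ + ‖lgM w‖ := by
          refine (norm_add_le _ _).trans ?_
          rw [norm_mul]
      _ ≤ 3 * |t| * 1 + CM := by gcongr
      _ ≤ (3 + CM) * |t| := by nlinarith

lemma slit_t {t : ℝ} (ht : t ≠ 0) (a : ℝ) : (t * I + a : ℂ) ∈ slitPlane := by
  right; simpa using ht

lemma slit_t0 {t : ℝ} (ht : t ≠ 0) : (t * I : ℂ) ∈ slitPlane := by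
  right; simpa using ht

lemma iter_an {f : ℂ → ℂ} {z : ℂ} (h : AnalyticAt ℂ f z) (j : ℕ) :
    AnalyticAt ℂ (iteratedDeriv j f) z := by
  induction j with
  | zero => simpa using h
  | succ j ih => rw [iteratedDeriv_succ]; exact ih.deriv

lemma H_deriv {L : ℂ → ℂ} (hL : IsLogGamma L) {t : ℝ} (ht : t ≠ 0) (j : ℕ) (a : ℝ) :
    HasDerivAt (fun a : ℝ => iteratedDeriv j L (t * I + a)) (iteratedDeriv (j+1) L (t * I + a)) a := by
  have h1 : HasDerivAt (iteratedDeriv j L) (iteratedDeriv (j+1) L (t * I + a)) (t * I + a) := by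
    rw [iteratedDeriv_succ]
    exact (iter_an (L_an hL (slit_t ht a)) j).differentiableAt.hasDerivAt
  have h2 : HasDerivAt (fun u : ℝ => (t * I + u : ℂ)) 1 a :=
    (Complex.ofRealCLM.hasDerivAt (x := a)).const_add _
  have h3 := h1.comp a h2
  rw [mul_one] at h3
  exact h3

lemma H_diff {L : ℂ → ℂ} (hL : IsLogGamma L) {z : ℂ} (hz : z ∈ slitPlane) (k : ℕ) :
    iteratedDeriv k L (z + 1) - iteratedDeriv k L z = iteratedDeriv k Complex.log z := by
  have e1 : iteratedDeriv k L (z + 1) = iteratedDeriv k (fun w => L (w + 1)) z := by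
    rw [iteratedDeriv_comp_add_const]
  have e2 : (fun w => L (w + 1)) =ᶠ[𝓝 z] L + Complex.log := by
    filter_upwards [Complex.isOpen_slitPlane.mem_nhds hz] with w hw
    exact L_succ hL hw
  rw [e1, e2.iteratedDeriv_eq, iteratedDeriv_add (L_an hL hz).contDiffAt
    (analyticAt_clog hz).contDiffAt]
  ring

def lgQ (t : ℝ) : ℂ := t * I * Complex.log (t * I) - t * I

lemma lgQ_deriv {t : ℝ} (ht : t ≠ 0) : HasDerivAt lgQ (I * Complex.log (t * I)) t := by
  have h1 : HasDerivAt (fun u : ℝ => (u * I : ℂ)) (1 * I) t :=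
    (Complex.ofRealCLM.hasDerivAt (x := t)).mul_const I
  have h2 := h1.clog_real (slit_t0 ht)
  have h3 := (h1.mul h2).sub h1
  refine HasDerivAt.congr_deriv h3 ?_
  have : (t:ℂ) ≠ 0 := by exact_mod_cast ht
  field_simp
  ring

lemma mean_const {L : ℂ → ℂ} (hL : IsLogGamma L) {t₁ t₂ : ℝ}
    (h : ∀ y ∈ Set.uIcc t₁ t₂, y ≠ 0) :
    (∫ x in (0:ℝ)..1, L (t₁ * I + x)) - lgQ t₁ = (∫ x in (0:ℝ)..1, L (t₂ * I + x)) - lgQ t₂ := by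
  have hr := Complex.integral_boundary_rect_eq_zero_of_differentiableOn L (t₁ * I) (1 + t₂ * I) ?_
  · simp only [Complex.mul_re, Complex.ofReal_re, Complex.I_re, Complex.ofReal_im, Complex.I_im,
      Complex.mul_im, Complex.add_re, Complex.add_im, Complex.one_re, Complex.one_im, mul_zero,
      mul_one, sub_zero, add_zero, zero_add, Complex.ofReal_zero, Complex.ofReal_one,
      smul_eq_mul] at hr
    have hc : ∀ b : ℝ, ContinuousOn (fun y : ℝ => L (b + y * I)) (Set.uIcc t₁ t₂) := by
      intro b y hy
      apply ContinuousAt.continuousWithinAt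
      have hm : (b + y * I : ℂ) ∈ slitPlane := by right; simpa using h y hy
      exact ContinuousAt.comp (f := fun y : ℝ => (b + y * I : ℂ)) (L_an hL hm).continuousAt
        (by fun_prop)
    have i1 : IntervalIntegrable (fun y : ℝ => L (1 + y * I)) volume t₁ t₂ := by
      simpa using (hc 1).intervalIntegrable
    have i0 : IntervalIntegrable (fun y : ℝ => L (y * I)) volume t₁ t₂ := by
      simpa using (hc 0).intervalIntegrable
    have hq : ∫ y in t₁..t₂, I * Complex.log (y * I) = lgQ t₂ - lgQ t₁ := by
      apply intervalIntegral.integral_eq_sub_of_hasDerivAt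
      · intro y hy; exact lgQ_deriv (h y hy)
      · apply ContinuousOn.intervalIntegrable
        intro y hy
        apply ContinuousAt.continuousWithinAt
        apply ContinuousAt.mul continuousAt_const
        exact ContinuousAt.comp (f := fun y : ℝ => (y * I : ℂ))
          (continuousAt_clog (slit_t0 (h y hy))) (by fun_prop)
    have hd : (∫ y in t₁..t₂, L (1 + y * I)) - (∫ y in t₁..t₂, L (y * I))
        = ∫ y in t₁..t₂, Complex.log (y * I) := by
      rw [← intervalIntegral.integral_sub i1 i0]
      apply intervalIntegral.integral_congr
      intro y hy
      simp only
      rw [add_comm, L_succ hL (slit_t0 (h y hy))]; ring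
    rw [intervalIntegral.integral_const_mul, ← hd] at hq
    simp only [add_comm (_ * I)]
    linear_combination hr - hq
  · intro z hz
    have : z.im ≠ 0 := by
      have := hz.2
      simp at this
      exact h _ this
    exact (L_an hL (Or.inr this)).differentiableAt.differentiableWithinAt

lemma mean_L {L : ℂ → ℂ} (hL : IsLogGamma L) {t : ℝ} (ht : t ≠ 0) :
    ∫ x in (0:ℝ)..1, L (t * I + x) = lgQ t + (Real.log (2*π) : ℂ)/2 := by
  set c : ℂ := (Real.log (2*π) : ℂ)/2 with hcdef
  obtain ⟨C, hC⟩ := L_deriv_bound hL 1 1 le_rfl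
  have hbig : ∀ t : ℝ, 2 ≤ |t| →
      ‖lgM (t * I) - ((∫ x in (0:ℝ)..1, L (t * I + x)) - lgQ t - c)‖ ≤ 4 * (C / |t|) := by
    intro t h2
    have h0 : t ≠ 0 := by intro h; rw [h] at h2; norm_num at h2
    have := emac (K := 1) le_rfl 1 (fun j a => iteratedDeriv j L (t * I + a))
      (fun j a => H_deriv hL h0 j a) (C / |t|^1) (fun a ha => hC t a h2 (by linarith) ha) 0 (by simp)
    simp only [Finset.range_one, Finset.sum_singleton, Complex.ofReal_one, Complex.ofReal_zero,
      add_zero, H_diff hL (slit_t0 h0), iteratedDeriv_zero] at this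
    rw [L_eq hL (slit_t0 h0)] at this
    refine le_trans (le_of_eq ?_) (this.trans (le_of_eq ?_))
    · congr 1
      simp [bb, lgG, lgQ]
      ring
    · norm_num
  have hseq : Tendsto (fun n : ℕ => |t * ((n:ℝ)+1)|) atTop atTop := by
    simp only [abs_mul]
    apply Tendsto.const_mul_atTop (abs_pos.mpr ht)
    apply tendsto_abs_atTop_atTop.comp
    exact tendsto_atTop_add_const_right _ _ tendsto_natCast_atTop_atTop
  have h1 := lgM_tendsto hseq
  have h2 : Tendsto (fun n : ℕ => lgM ((t * ((n:ℝ)+1) : ℝ) * I) -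
      ((∫ x in (0:ℝ)..1, L (t * I + x)) - lgQ t - c)) atTop (𝓝 0) := by
    rw [tendsto_zero_iff_norm_tendsto_zero]
    have h0 : Tendsto (fun n : ℕ => 4 * (C / |t * ((n:ℝ)+1)|)) atTop (𝓝 0) := by
      simpa using (hseq.const_div_atTop C).const_mul 4
    refine tendsto_of_tendsto_of_tendsto_of_le_of_le' tendsto_const_nhds h0
      (Eventually.of_forall fun _ => norm_nonneg _) ?_
    filter_upwards [hseq.eventually_ge_atTop 2] with n hn
    have := hbig _ hn
    rwa [← mean_const hL (t₁ := t)] at this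
    intro y hy
    rw [Set.mem_uIcc] at hy
    have hn0 : (0:ℝ) ≤ n := Nat.cast_nonneg n
    rintro rfl
    rcases lt_or_gt_of_ne ht with h | h
    · rcases hy with hy | hy
      · nlinarith [hy.2]
      · linarith [hy.2]
    · rcases hy with hy | hy
      · linarith [hy.1]
      · nlinarith [hy.1]
  have h3 := tendsto_nhds_unique (h1.sub h2)
    (tendsto_const_nhds (x := (∫ x in (0:ℝ)..1, L (t * I + x)) - lgQ t - c) |>.congr
      (fun n => by ring))
  rw [sub_zero] at h3
  linear_combination -h3

lemma bern_eq (k : ℕ) (a : ℝ) : bernoulliPoly k (a:ℂ) = (bernoulliFun k a : ℂ) := by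
  unfold bernoulliPoly bernoulliFun
  rw [Polynomial.eval_map_algebraMap]
  exact Polynomial.aeval_algebraMap_apply ℂ a (Polynomial.bernoulli k)

lemma sum_Icc_range (f : ℕ → ℂ) (n : ℕ) :
    ∑ k ∈ Finset.Icc 1 n, f k = ∑ k ∈ Finset.range n, f (k+1) := by
  induction n with
  | zero => simp
  | succ n ih => rw [Finset.sum_Icc_succ_top (by omega), ih, Finset.sum_range_succ]

lemma term_eq {t : ℝ} (ht : t ≠ 0) (n : ℕ) (a : ℝ) :
    iteratedDeriv (n+1) Complex.log (t * I) * bb (n+1+1) a =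
    - ((I/(t:ℂ))^(n+1) * bernoulliPoly (n+1+1) (a:ℂ) / (((n+1:ℕ):ℂ)*(((n+1:ℕ):ℂ)+1))) := by
  have htc : (t:ℂ) ≠ 0 := by exact_mod_cast ht
  have hz : (t * I : ℂ) ≠ 0 := mul_ne_zero htc I_ne_zero
  have hi : I / (t:ℂ) = - (t * I)⁻¹ := by
    field_simp; simp
  have hn1 : (n + 1 : ℂ) ≠ 0 := by exact_mod_cast n.succ_ne_zero
  have hn2 : (n + 1 + 1 : ℂ) ≠ 0 := by exact_mod_cast (n+1).succ_ne_zero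
  have hf : (n.factorial : ℂ) ≠ 0 := by exact_mod_cast n.factorial_ne_zero
  rw [iteratedDeriv_succ_log (slit_t0 ht), bern_eq, hi, bb]
  have e : (t * I : ℂ)^(-(n:ℤ) - 1) = ((t * I : ℂ)⁻¹)^(n+1) := by
    rw [inv_pow, ← zpow_natCast, ← zpow_neg]; congr 1; push_cast; ring
  rw [e, neg_pow ((t * I : ℂ)⁻¹)]
  generalize ((t * I : ℂ)⁻¹)^(n+1) = X
  rw [Nat.factorial_succ, Nat.factorial_succ]
  push_cast
  field_simp
  ring

lemma big_t {L : ℂ → ℂ} (hL : IsLogGamma L) (K : ℝ) (hK : 1 ≤ K) (N : ℕ) (hN : 1 ≤ N) :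
    ∃ C : ℝ, ∀ s : ℂ, |s.re| ≤ K → 2 * K ≤ |s.im| →
      ‖L s - (s - 1/2) * Complex.log (I * (s.im:ℂ)) + I * (s.im:ℂ)
          - (Real.log (2*π) : ℂ)/2
          + ∑ k ∈ Finset.Icc 1 (N-1),
              (I/(s.im:ℂ))^k * bernoulliPoly (k+1) (s.re:ℂ) / ((k:ℂ)*((k:ℂ)+1))‖
        ≤ C / |s.im|^N := by
  obtain ⟨C, hC⟩ := L_deriv_bound hL K N hN
  refine ⟨(2*K)^(N+1) * C, ?_⟩
  intro s hre him
  set t := s.im with ht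
  set a := s.re with ha
  have h0 : t ≠ 0 := by intro h; rw [h] at him; simp at him; linarith
  have hs : s = t * I + a := by rw [add_comm]; exact (Complex.re_add_im s).symm
  have := emac hK N (fun j a => iteratedDeriv j L (t * I + a))
      (fun j a => H_deriv hL h0 j a) (C / |t|^N)
      (fun a ha => hC t a (by linarith) him ha) a hre
  simp only [Complex.ofReal_one, Complex.ofReal_zero,
      add_zero, H_diff hL (slit_t0 h0), iteratedDeriv_zero, mean_L hL h0] at this
  obtain ⟨n, rfl⟩ : ∃ n, N = n + 1 := ⟨N - 1, by omega⟩
  refine le_trans (le_of_eq ?_) (this.trans (le_of_eq ?_))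
  · congr 1
    rw [Finset.sum_range_succ', Nat.add_sub_cancel, sum_Icc_range]
    simp only [term_eq h0]
    rw [Finset.sum_neg_distrib, hs, mul_comm I]
    simp [bb, lgQ]
    ring
  · ring

lemma log_bound {w : ℂ} {τ R : ℝ} (hτ : 0 < τ) (h1 : τ ≤ ‖w‖) (h2 : ‖w‖ ≤ R) :
    ‖Complex.log w‖ ≤ R + π + 1/τ := by
  have hw : 0 < ‖w‖ := by linarith
  have e1 : ‖Complex.log w‖ ≤ |Real.log ‖w‖| + |w.arg| := by
    have := Complex.norm_le_abs_re_add_abs_im (Complex.log w)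
    rwa [Complex.log_re, Complex.log_im] at this
  have e2 := Complex.abs_arg_le_pi w
  have e3 : |Real.log ‖w‖| ≤ R + 1/τ := by
    rw [abs_le]
    have a1 := Real.log_le_sub_one_of_pos hw
    have a2 := Real.log_le_sub_one_of_pos (inv_pos.mpr hw)
    rw [Real.log_inv] at a2
    have a3 : ‖w‖⁻¹ ≤ 1/τ := by rw [one_div]; gcongr
    have a4 : 0 < 1/τ := by positivity
    constructor <;> linarith
  linarith

lemma small_t {L : ℂ → ℂ} (hL : IsLogGamma L) (K : ℝ) (hK : 1 ≤ K) (N : ℕ) (hN : 1 ≤ N) :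
    ∃ C : ℝ, ∀ s : ℂ, |s.re| ≤ K → s.im ≠ 0 → |s.im| ≤ 2 * K →
      ‖L s - (s - 1/2) * Complex.log (I * (s.im:ℂ)) + I * (s.im:ℂ)
          - (Real.log (2*π) : ℂ)/2
          + ∑ k ∈ Finset.Icc 1 (N-1),
              (I/(s.im:ℂ))^k * bernoulliPoly (k+1) (s.re:ℂ) / ((k:ℂ)*((k:ℂ)+1))‖
        ≤ C / |s.im|^N := by
  obtain ⟨m, hm⟩ := exists_nat_ge (K + 1)
  set T := 2 * K with hT
  obtain ⟨B1, hB1⟩ : ∃ B1, ∀ w ∈ (Set.Icc 1 (K + m)) ×ℂ (Set.Icc (-T) T), ‖L w‖ ≤ B1 := by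
    apply (isCompact_Icc.reProdIm isCompact_Icc).exists_bound_of_continuousOn
    intro w hw
    have : 1 ≤ w.re := hw.1.1
    exact (L_an hL (Or.inl (by linarith))).continuousAt.continuousWithinAt
  have hb : ∀ k : ℕ, ∃ b, ∀ a ∈ Set.Icc (-K) K, ‖bernoulliFun k a‖ ≤ b := fun k =>
    isCompact_Icc.exists_bound_of_continuousOn (continuous_bernoulliFun k).continuousOn
  choose b hb using hb
  set c : ℂ := (Real.log (2*π) : ℂ)/2 with hc
  set R := K + T + m with hR
  set D : ℝ := (B1 + m * (R + π + 1)) + (K + T + 1) * (T + π + 1) + T + ‖c‖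
    + ∑ k ∈ Finset.Icc 1 (N-1), b (k+1) with hD
  refine ⟨D * T^N, ?_⟩
  intro s hre h0 him
  set t := s.im with ht
  set a := s.re with ha
  have hpos : 0 < |t| := abs_pos.mpr h0
  set X := T / |t| with hX
  have hX1 : 1 ≤ X := by rw [hX, one_le_div hpos]; exact him
  have hXt : 1 / |t| ≤ X := by rw [hX]; gcongr; linarith
  set Y := X^N with hY
  have hXY : ∀ k : ℕ, k ≤ N → X^k ≤ Y := fun k hk => pow_le_pow_right₀ hX1 hk
  have hY1 : 1 ≤ Y := by simpa using hXY 0 (by omega)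
  have htY : 1/|t| ≤ Y := hXt.trans (by simpa using hXY 1 hN)
  have hsn : ‖s‖ ≤ K + T := by
    refine (Complex.norm_le_abs_re_add_abs_im s).trans ?_
    linarith
  have hss : s ∈ slitPlane := Or.inr h0
  have habs := abs_le.mp hre
  have hK0 : 0 < K := by linarith
  have hlogY : ∀ w : ℂ, ∀ r : ℝ, 0 ≤ r → |t| ≤ ‖w‖ → ‖w‖ ≤ r → ‖Complex.log w‖ ≤ (r + π + 1) * Y := by
    intro w r hr h1 h2
    have := log_bound hpos h1 h2
    have hpi := Real.pi_pos
    nlinarith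
  have hB10 : 0 ≤ B1 := by
    refine (norm_nonneg _).trans (hB1 ((1:ℝ) + (0:ℝ) * I) ?_)
    rw [Complex.mem_reProdIm]; simp; constructor
    · linarith
    · linarith
  have q1 : ‖L s‖ ≤ (B1 + m * (R + π + 1)) * Y := by
    have e : L s = L (s + m) - ∑ n ∈ Finset.range m, Complex.log (s + n) := by
      rw [L_add hL hss m]; ring
    have e1 : ‖L (s + m)‖ ≤ B1 := by
      apply hB1
      rw [Complex.mem_reProdIm]
      simp only [Complex.add_re, Complex.add_im, Complex.natCast_re, Complex.natCast_im, add_zero]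
      exact ⟨⟨by linarith, by linarith⟩, abs_le.mp him⟩
    have e2 : ‖∑ n ∈ Finset.range m, Complex.log (s + n)‖ ≤ ∑ n ∈ Finset.range m, (R + π + 1) * Y := by
      apply norm_sum_le_of_le
      intro n hn
      apply hlogY _ _ (by positivity)
      · have := Complex.abs_im_le_norm (s + n); simpa using this
      · refine (norm_add_le _ _).trans ?_
        have : (n:ℝ) ≤ m := by exact_mod_cast (Finset.mem_range.mp hn).le
        simp only [Complex.norm_natCast]
        linarith
    rw [Finset.sum_const, Finset.card_range, nsmul_eq_mul] at e2
    rw [e]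
    refine (norm_sub_le _ _).trans ?_
    nlinarith
  have q2 : ‖(s - 1/2) * Complex.log (I * (t:ℂ))‖ ≤ (K + T + 1) * (T + π + 1) * Y := by
    rw [norm_mul, mul_assoc]
    have : ‖s - 1/2‖ ≤ K + T + 1 := by
      refine (norm_sub_le _ _).trans ?_
      norm_num; linarith
    gcongr
    apply hlogY _ _ (by positivity) <;> simp
    exact him
  have q3 : ‖I * (t:ℂ)‖ ≤ T * Y := by
    simp
    nlinarith
  have q4 : ‖c‖ ≤ ‖c‖ * Y := by nlinarith [norm_nonneg c]
  have q5 : ‖∑ k ∈ Finset.Icc 1 (N-1),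
      (I/(t:ℂ))^k * bernoulliPoly (k+1) (a:ℂ) / ((k:ℂ)*((k:ℂ)+1))‖
      ≤ (∑ k ∈ Finset.Icc 1 (N-1), b (k+1)) * Y := by
    rw [Finset.sum_mul]
    apply norm_sum_le_of_le
    intro k hk
    rw [Finset.mem_Icc] at hk
    have hk1 : (1:ℝ) ≤ k := by exact_mod_cast hk.1
    have hbk := hb (k+1) a habs
    rw [bern_eq, norm_div, norm_mul, norm_pow, norm_div, Complex.norm_real, Complex.norm_real,
      Complex.norm_I, Real.norm_eq_abs t]
    have hden : 1 ≤ ‖(k:ℂ)*((k:ℂ)+1)‖ := by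
      rw [show (k:ℂ)*((k:ℂ)+1) = ((k * (k+1) : ℝ) : ℂ) by push_cast; ring, Complex.norm_real,
        Real.norm_eq_abs, abs_of_nonneg (by positivity)]
      nlinarith
    have hb0 : 0 ≤ ‖bernoulliFun (k+1) a‖ := norm_nonneg _
    have hpw : (1/|t|)^k ≤ Y := (pow_le_pow_left₀ (by positivity) hXt k).trans (hXY k (by omega))
    refine (div_le_self (by positivity) hden).trans ?_
    rw [mul_comm]
    gcongr
    linarith
  have htot : D * T^N / |t|^N = D * Y := by rw [hY, hX, div_pow]; ring
  rw [htot]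
  calc _ ≤ ‖L s‖ + ‖(s - 1/2) * Complex.log (I * (t:ℂ))‖ + ‖I * (t:ℂ)‖ + ‖c‖ + _ := by
        refine (norm_add_le _ _).trans ?_
        gcongr
        refine (norm_sub_le _ _).trans ?_
        gcongr
        refine (norm_add_le _ _).trans ?_
        gcongr
        exact norm_sub_le _ _
    _ ≤ _ := add_le_add (add_le_add (add_le_add (add_le_add q1 q2) q3) q4) q5
    _ = D * Y := by rw [hD]; ring

theorem statement15 (A B : ℝ) (N : ℕ) (hN : 1 ≤ N) (L : ℂ → ℂ) (hL : IsLogGamma L) :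
    ∃ C : ℝ, ∀ s : ℂ, s.re ∈ Set.Icc A B → s.im ≠ 0 →
      ‖L s - (s - 1/2) * Complex.log (I * (s.im:ℂ)) + I * (s.im:ℂ)
          - (Real.log (2*π) : ℂ)/2
          + ∑ k ∈ Finset.Icc 1 (N-1),
              (I/(s.im:ℂ))^k * bernoulliPoly (k+1) (s.re:ℂ) / ((k:ℂ)*((k:ℂ)+1))‖
        ≤ C / |s.im|^N := by
  set K : ℝ := 1 + |A| + |B| with hKdef
  have hK : 1 ≤ K := by have := abs_nonneg A; have := abs_nonneg B; linarith
  obtain ⟨C1, h1⟩ := big_t hL K hK N hN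
  obtain ⟨C2, h2⟩ := small_t hL K hK N hN
  refine ⟨max C1 C2, fun s hs him => ?_⟩
  have hre : |s.re| ≤ K := by
    rw [abs_le]
    have := neg_abs_le A; have := le_abs_self B
    have := abs_nonneg A; have := abs_nonneg B
    constructor <;> linarith [hs.1, hs.2]
  have hp : 0 < |s.im| := abs_pos.mpr him
  rcases le_total (2*K) |s.im| with h | h
  · refine (h1 s hre h).trans ?_
    gcongr; exact le_max_left _ _
  · refine (h2 s hre him h).trans ?_
    gcongr; exact le_max_right _ _

end
end
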